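/- Two DAGs G and G' on Fin p are Markov equivalent if and only if there exists a finite sequence of DAGs G = G_0, G_1, …, G_M = G' in which each G_{t+1} is obtained from G_t by reversing a single covered edge of G_t. -/

import Mathlib

namespace CausalDiscovery

variable {V : Type*}

/-- A relation is acyclic if it has no directed cycles. -/
def Acyclic (E : V → V → Prop) : Prop :=
  ∀ v, ¬ Relation.TransGen E v v

/-- `i` and `j` are adjacent (joined by an edge in either direction). -/
def Adj (E : V → V → Prop) (i j : V) : Prop :=
  E i j ∨ E j i

/-- `j` is a descendant of `i`, i.e. reachable from `i` by a directed path. -/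
def Desc (E : V → V → Prop) (i j : V) : Prop :=
  Relation.ReflTransGen E i j

/-- `f 0, f 1, …, f n` is a path between `i` and `j`: the vertices are distinct and
consecutive vertices are adjacent. -/
def IsPath (E : V → V → Prop) (n : ℕ) (f : ℕ → V) (i j : V) : Prop :=
  0 < n ∧ f 0 = i ∧ f n = j ∧
    (∀ s t, s ≤ n → t ≤ n → f s = f t → s = t) ∧
    ∀ t, t < n → Adj E (f t) (f (t + 1))

/-- The vertex at (interior) position `t` of the path `f` is a collider:
both edges of the path at that vertex point into it. -/
def ColliderAt (E : V → V → Prop) (f : ℕ → V) (t : ℕ) : Prop :=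
  E (f (t - 1)) (f t) ∧ E (f (t + 1)) (f t)

/-- The path `f 0, …, f n` d-connects its endpoints given `C`: every non-collider
interior vertex is outside `C`, every collider is in `C` or has a descendant in `C`. -/
def DConn (E : V → V → Prop) (n : ℕ) (f : ℕ → V) (C : Finset V) : Prop :=
  ∀ t, 0 < t → t < n →
    (ColliderAt E f t → f t ∈ C ∨ ∃ d ∈ C, Desc E (f t) d) ∧
    (¬ ColliderAt E f t → f t ∉ C)

/-- `i` and `j` are d-separated given `C`: no path between them d-connects given `C`. -/
def DSep (E : V → V → Prop) (i j : V) (C : Finset V) : Prop :=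
  ∀ n f, IsPath E n f i j → ¬ DConn E n f C

/-- The independence model `I(E)`: all d-separation triples `(i, j, C)` with `i, j`
distinct and `C ⊆ V \ {i, j}`. -/
def Indep (E : V → V → Prop) : Set (V × V × Finset V) :=
  {x | x.1 ≠ x.2.1 ∧ x.1 ∉ x.2.2 ∧ x.2.1 ∉ x.2.2 ∧ DSep E x.1 x.2.1 x.2.2}

/-- Two graphs are Markov equivalent if they have the same independence model. -/
def MarkovEquiv (E E' : V → V → Prop) : Prop :=
  Indep E = Indep E'

/-- Two graphs have the same skeleton if they have the same adjacencies. -/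
def SameSkeleton (E E' : V → V → Prop) : Prop :=
  ∀ i j, Adj E i j ↔ Adj E' i j

/-- The v-structures of a graph: triples `(i, j, k)` with `i → j ← k` and `i, k`
not adjacent. -/
def VStruct (E : V → V → Prop) : Set (V × V × V) :=
  {x | E x.1 x.2.1 ∧ E x.2.2 x.2.1 ∧ x.1 ≠ x.2.2 ∧ ¬ Adj E x.1 x.2.2}


/-- The edge `i → j` is a covered edge: `pa(i) = pa(j) \ {i}`. -/
def Covered (E : V → V → Prop) (i j : V) : Prop :=
  E i j ∧ ∀ k, E k i ↔ E k j ∧ k ≠ i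

/-- The graph obtained by reversing the edge `i → j` to `j → i`, keeping all
other edges. -/
def ReverseEdge (E : V → V → Prop) (i j : V) : V → V → Prop :=
  fun a b => (E a b ∧ ¬(a = i ∧ b = j)) ∨ (a = j ∧ b = i)

/-- `E'` (a DAG) is obtained from the DAG `E` by reversing a single covered edge. -/
def CoveredFlip (E E' : V → V → Prop) : Prop :=
  Acyclic E ∧ Acyclic E' ∧ ∃ i j, Covered E i j ∧ E' = ReverseEdge E i j


section Helpers

variable {E : V → V → Prop} {C : Finset V}

theorem Acyclic.not_self (h : Acyclic E) (v : V) : ¬ E v v :=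
  fun hv => h v (.single hv)

theorem Acyclic.asymm (h : Acyclic E) {u v : V} (huv : E u v) : ¬ E v u :=
  fun hvu => h u (.tail (.single huv) hvu)

theorem Acyclic.wellFounded [Finite V] (h : Acyclic E) : WellFounded E := by
  have : Std.Irrefl (Relation.TransGen E) := ⟨h⟩
  exact Subrelation.wf (r := Relation.TransGen E) (fun h => .single h)
    (Finite.wellFounded_of_trans_of_irrefl _)

theorem Acyclic.flip (h : Acyclic E) : Acyclic (fun a b => E b a) := by
  intro v hv
  exact h v (Relation.transGen_swap.mp hv)

theorem Adj.symm {u v : V} (h : Adj E u v) : Adj E v u := Or.symm h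

/-- `v` is in `C` or is an ancestor of a vertex of `C`. -/
def AncestorOf (E : V → V → Prop) (C : Finset V) (v : V) : Prop :=
  v ∈ C ∨ ∃ d ∈ C, Desc E v d

/-- The vertex `v`, lying between `a` and `b` on a path, does not block the path given `C`. -/
def Active (E : V → V → Prop) (C : Finset V) (a v b : V) : Prop :=
  (E a v ∧ E b v → AncestorOf E C v) ∧ (¬ (E a v ∧ E b v) → v ∉ C)

theorem Active.symm {a v b : V} (h : Active E C a v b) : Active E C b v a :=
  ⟨fun hc => h.1 hc.symm, fun hc => h.2 fun hc' => hc hc'.symm⟩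

theorem dConn_iff {n : ℕ} {f : ℕ → V} :
    DConn E n f C ↔ ∀ t, 0 < t → t < n → Active E C (f (t - 1)) (f t) (f (t + 1)) :=
  Iff.rfl

theorem IsPath.reverse {n : ℕ} {f : ℕ → V} {x y : V} (h : IsPath E n f x y) :
    IsPath E n (fun t => f (n - t)) y x := by
  obtain ⟨hn, h0, h1, hinj, hadj⟩ := h
  refine ⟨hn, by simpa using h1, by simpa using h0, fun s t hs ht hst => ?_, fun t ht => ?_⟩
  · have := hinj _ _ (Nat.sub_le n s) (Nat.sub_le n t) hst
    omega
  · have := (hadj (n - (t + 1)) (by omega)).symm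
    rwa [show n - (t + 1) + 1 = n - t by omega] at this

theorem DConn.reverse {n : ℕ} {f : ℕ → V} (h : DConn E n f C) :
    DConn E n (fun t => f (n - t)) C := by
  rw [dConn_iff] at h ⊢
  intro t h0 hn
  have := (h (n - t) (by omega) (by omega)).symm
  rwa [show n - t + 1 = n - (t - 1) by omega, show n - t - 1 = n - (t + 1) by omega] at this

theorem DSep.symm {x y : V} (h : DSep E x y C) : DSep E y x C :=
  fun _ _ hf hd => h _ _ hf.reverse hd.reverse

theorem not_dSep_iff {x y : V} :
    ¬ DSep E x y C ↔ ∃ n f, IsPath E n f x y ∧ DConn E n f C := by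
  simp [DSep]

theorem not_dSep_of_adj {x y : V} (hxy : x ≠ y) (h : Adj E x y) : ¬ DSep E x y C := by
  refine not_dSep_iff.mpr ⟨1, fun t => if t = 0 then x else y, ⟨one_pos, by simp, by simp, ?_, ?_⟩,
    fun t h0 h1 => by omega⟩
  · intro s t hs ht hst
    interval_cases s <;> interval_cases t <;> simp_all
  · intro t ht
    interval_cases t
    simpa using h

theorem DSep.not_active {a b c : V} (h : DSep E a c C) (hab : a ≠ b) (hbc : b ≠ c) (hac : a ≠ c)
    (h1 : Adj E a b) (h2 : Adj E b c) : ¬ Active E C a b c := by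
  intro hact
  refine h 2 (fun t => if t = 0 then a else if t = 1 then b else c)
    ⟨two_pos, by simp, by simp, ?_, ?_⟩ ?_
  · intro s t hs ht hst
    interval_cases s <;> interval_cases t <;> simp_all
  · intro t ht
    interval_cases t <;> simpa
  · rw [dConn_iff]
    intro t h0 h1
    obtain rfl : t = 1 := by omega
    simpa using hact

theorem dSep_parents (hE : Acyclic E) {x y : V} (hadj : ¬ Adj E x y)
    (hyx : ¬ Relation.TransGen E y x) (hC : ∀ v, v ∈ C ↔ E v y) : DSep E x y C := by
  rintro n f ⟨hn, h0, h1, -, hpath⟩ hd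
  rw [dConn_iff] at hd
  have hn2 : 2 ≤ n := by
    by_contra hlt
    obtain rfl : n = 1 := by omega
    exact hadj (by simpa [h0, h1] using hpath 0 one_pos)
  have key : ∀ k, k < n → E (f (n - 1 - k + 1)) (f (n - 1 - k)) ∧
      Relation.TransGen E y (f (n - 1 - k)) := by
    intro k
    induction k with
    | zero =>
      intro _
      have hlast := hpath (n - 1) (by omega)
      have hsucc : n - 1 + 1 = n := by omega
      simp only [Nat.sub_zero, hsucc, h1] at hlast ⊢
      rcases hlast with h | h
      · have := (hd (n - 1) (by omega) (by omega)).2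
        rw [hsucc, h1] at this
        exact absurd ((hC _).mpr h) (this fun hc => hE.asymm h hc.2)
      · exact ⟨h, .single h⟩
    | succ k ih =>
      intro hk
      obtain ⟨hedge, hreach⟩ := ih (by omega)
      obtain ⟨m, hm⟩ : ∃ m, n - 1 - k = m + 1 := ⟨n - 1 - k - 1, by omega⟩
      rw [hm] at hedge hreach
      rw [show n - 1 - (k + 1) = m by omega]
      rcases hpath m (by omega) with h | h
      · exfalso
        have hanc := (hd (m + 1) (by omega) (by omega)).1 ⟨h, hedge⟩
        obtain ⟨d, hdC, hdesc⟩ : ∃ d ∈ C, Desc E (f (m + 1)) d := by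
          rcases hanc with hm | hm
          · exact ⟨_, hm, .refl⟩
          · exact hm
        exact hE y ((hreach.trans_left hdesc).tail ((hC d).mp hdC))
      · exact ⟨h, hreach.tail h⟩
  have := (key (n - 1) (by omega)).2
  rw [Nat.sub_self, h0] at this
  exact hyx this

theorem exists_mem_indep_of_not_adj [Finite V] (hE : Acyclic E) {x y : V} (hxy : x ≠ y)
    (hadj : ¬ Adj E x y) : ∃ C, (x, y, C) ∈ Indep E := by
  have hfin (v : V) : ∃ C : Finset V, ∀ u, u ∈ C ↔ E u v :=
    ⟨(Set.toFinite {u | E u v}).toFinset, by simp⟩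
  by_cases hyx : Relation.TransGen E y x
  · obtain ⟨C, hC⟩ := hfin x
    refine ⟨C, hxy, fun h => hE.not_self _ ((hC _).mp h), fun h => hadj (.inr ((hC _).mp h)),
      (dSep_parents hE (fun h => hadj h.symm) (fun h => hE _ (h.trans hyx)) hC).symm⟩
  · obtain ⟨C, hC⟩ := hfin y
    exact ⟨C, hxy, fun h => hadj (.inl ((hC _).mp h)), fun h => hE.not_self _ ((hC _).mp h),
      dSep_parents hE hadj hyx hC⟩

variable {E' : V → V → Prop}

theorem MarkovEquiv.adj_of_adj [Finite V] (hE : Acyclic E) (hE' : Acyclic E')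
    (h : MarkovEquiv E E') {x y : V} (hxy : Adj E x y) : Adj E' x y := by
  by_contra hadj
  have hne : x ≠ y := by
    rintro rfl
    exact hxy.elim (hE.not_self x) (hE.not_self x)
  obtain ⟨C, hC⟩ := exists_mem_indep_of_not_adj hE' hne hadj
  rw [← h] at hC
  exact not_dSep_of_adj hne hxy hC.2.2.2

theorem MarkovEquiv.sameSkeleton [Finite V] (hE : Acyclic E) (hE' : Acyclic E')
    (h : MarkovEquiv E E') : SameSkeleton E E' :=
  fun _ _ => ⟨h.adj_of_adj hE hE', MarkovEquiv.adj_of_adj hE' hE (Eq.symm h)⟩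

theorem MarkovEquiv.edge_of_vStruct [Finite V] (hE : Acyclic E) (hE' : Acyclic E')
    (h : MarkovEquiv E E') {a b c : V} (hab : E a b) (hcb : E c b) (hac : a ≠ c)
    (hadj : ¬ Adj E a c) : E' a b := by
  obtain ⟨C, hC⟩ := exists_mem_indep_of_not_adj hE hac hadj
  have hne1 : a ≠ b := by rintro rfl; exact hE.not_self _ hab
  have hne2 : b ≠ c := by rintro rfl; exact hE.not_self _ hcb
  have hbC : b ∉ C := fun hb => hC.2.2.2.not_active hne1 hne2 hac (.inl hab) (.inr hcb)
    ⟨fun _ => .inl hb, fun hn => absurd ⟨hab, hcb⟩ hn⟩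
  have hS := h.sameSkeleton hE hE'
  rw [h] at hC
  by_contra hn
  exact hC.2.2.2.not_active hne1 hne2 hac ((hS _ _).mp (.inl hab)) ((hS _ _).mp (.inr hcb))
    ⟨fun hc => absurd hc.1 hn, fun _ => hbC⟩

/-- Shortcutting a path between the positions `s < t`. -/
theorem exists_dConn_of_shortcut {n : ℕ} {f : ℕ → V} {x y : V} (hf : IsPath E n f x y) {s t : ℕ}
    (hst : s < t) (ht : t ≤ n) (hadj : Adj E (f s) (f t))
    (hleft : ∀ u, 0 < u → u < s → Active E C (f (u - 1)) (f u) (f (u + 1)))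
    (hright : ∀ u, t < u → u < n → Active E C (f (u - 1)) (f u) (f (u + 1)))
    (hs : 0 < s → Active E C (f (s - 1)) (f s) (f t))
    (htn : t < n → Active E C (f s) (f t) (f (t + 1))) :
    ∃ n g, IsPath E n g x y ∧ DConn E n g C := by
  obtain ⟨hn, h0, h1, hinj, hpath⟩ := hf
  obtain ⟨k, rfl⟩ : ∃ k, t = s + 1 + k := ⟨t - (s + 1), by omega⟩
  refine ⟨n - k, fun u => if u ≤ s then f u else f (u + k),
    ⟨by omega, by simpa using h0, ?_, ?_, ?_⟩, ?_⟩
  · simp only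
    rw [if_neg (by omega), Nat.sub_add_cancel (by omega), h1]
  · intro u v hu hv huv
    simp only at huv
    split_ifs at huv <;> have := hinj _ _ (by omega) (by omega) huv <;> omega
  · intro u hu
    simp only
    rcases lt_trichotomy u s with h | rfl | h
    · rw [if_pos h.le, if_pos (by omega)]
      exact hpath u (by omega)
    · rw [if_pos le_rfl, if_neg (by omega)]
      exact hadj
    · rw [if_neg (by omega), if_neg (by omega), show u + 1 + k = u + k + 1 by omega]
      exact hpath (u + k) (by omega)
  · rw [dConn_iff]
    intro u hu0 hun
    rcases lt_trichotomy u s with h | rfl | h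
    · rw [if_pos h.le, if_pos (by omega), if_pos (by omega)]
      exact hleft u hu0 h
    · rw [if_pos (by omega), if_pos le_rfl, if_neg (by omega)]
      exact hs hu0
    · rcases eq_or_ne u (s + 1) with rfl | h'
      · rw [if_pos (by omega), if_neg (by omega), if_neg (by omega),
          show s + 1 + 1 + k = s + 1 + k + 1 by omega]
        exact htn (by omega)
      · rw [if_neg (by omega), if_neg (by omega), if_neg (by omega),
          show u + 1 + k = u + k + 1 by omega, show u - 1 + k = u + k - 1 by omega]
        exact hright (u + k) (by omega) (by omega)

/-- Replacing the vertex at position `s` of a path by a vertex `w` off the path. -/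
theorem exists_dConn_of_replace {n : ℕ} {f : ℕ → V} {x y w : V} (hf : IsPath E n f x y) {s : ℕ}
    (hs0 : 0 < s) (hsn : s < n) (hw : ∀ u ≤ n, f u ≠ w)
    (hadj1 : Adj E (f (s - 1)) w) (hadj2 : Adj E w (f (s + 1)))
    (hother : ∀ u, 0 < u → u < n → u + 1 ≠ s → u ≠ s → u ≠ s + 1 →
      Active E C (f (u - 1)) (f u) (f (u + 1)))
    (hprev : 1 < s → Active E C (f (s - 2)) (f (s - 1)) w)
    (hmid : Active E C (f (s - 1)) w (f (s + 1)))
    (hnext : s + 1 < n → Active E C w (f (s + 1)) (f (s + 2))) :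
    ∃ n g, IsPath E n g x y ∧ DConn E n g C := by
  obtain ⟨hn, h0, h1, hinj, hpath⟩ := hf
  refine ⟨n, fun u => if u = s then w else f u, ⟨hn, ?_, ?_, ?_, ?_⟩, ?_⟩
  · simpa [hs0.ne] using h0
  · simpa [hsn.ne'] using h1
  · intro u v hu hv huv
    simp only at huv
    split_ifs at huv with h h' h'
    · omega
    · exact absurd huv.symm (hw v hv)
    · exact absurd huv (hw u hu)
    · exact hinj _ _ hu hv huv
  · intro u hu
    simp only
    rcases eq_or_ne u s with rfl | h
    · rw [if_pos rfl, if_neg (by omega)]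
      exact hadj2
    · rw [if_neg h]
      split_ifs with h'
      · subst h'
        exact hadj1
      · exact hpath u hu
  · rw [dConn_iff]
    intro u hu0 hun
    rcases eq_or_ne u s with rfl | h
    · rw [if_neg (by omega), if_pos rfl, if_neg (by omega)]
      exact hmid
    rcases eq_or_ne (u + 1) s with rfl | h'
    · rw [if_neg (by omega), if_neg (by omega), if_pos rfl]
      exact hprev (by omega)
    rcases eq_or_ne u (s + 1) with rfl | h''
    · rw [if_pos (by omega), if_neg (by omega), if_neg (by omega)]
      exact hnext (by omega)
    · rw [if_neg (by omega), if_neg (by omega), if_neg (by omega)]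
      exact hother u hu0 hun h' h h''

variable {i j : V}

theorem reverseEdge_iff_of_ne {a b : V} (h1 : ¬ (a = i ∧ b = j)) (h2 : ¬ (a = j ∧ b = i)) :
    ReverseEdge E i j a b ↔ E a b := by
  simp [ReverseEdge, h1, h2]

theorem reverseEdge_self : ReverseEdge E i j j i := .inr ⟨rfl, rfl⟩

theorem Covered.ne (hE : Acyclic E) (h : Covered E i j) : i ≠ j := by
  rintro rfl
  exact hE.not_self _ h.1

theorem Covered.adj_reverseEdge_iff (h : Covered E i j) (a b : V) :
    Adj (ReverseEdge E i j) a b ↔ Adj E a b := by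
  have := h.1
  unfold Adj ReverseEdge
  grind

theorem Covered.acyclic_reverseEdge (hE : Acyclic E) (h : Covered E i j) :
    Acyclic (ReverseEdge E i j) := by
  let E₀ : V → V → Prop := fun a b => E a b ∧ ¬ (a = i ∧ b = j)
  have hle {a b : V} (hab : Relation.ReflTransGen E₀ a b) : Relation.ReflTransGen E a b :=
    Relation.ReflTransGen.mono (fun _ _ h => h.1) _ _ hab
  have hij : ¬ Relation.ReflTransGen E₀ i j := by
    intro hij
    rcases hij.cases_tail with heq | ⟨k, hik, hkj, hk⟩
    · exact h.ne hE heq.symm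
    · have hki : E k i := (h.2 k).mpr ⟨hkj, fun hk' => hk ⟨hk', rfl⟩⟩
      exact hE i (Relation.TransGen.tail' (hle hik) hki)
  have key {a b : V} (hab : Relation.TransGen (ReverseEdge E i j) a b) :
      Relation.TransGen E₀ a b ∨
        (Relation.ReflTransGen E₀ a j ∧ Relation.ReflTransGen E₀ i b) := by
    induction hab with
    | single hab =>
      rcases hab with hab | ⟨rfl, rfl⟩
      · exact .inl (.single hab)
      · exact .inr ⟨.refl, .refl⟩
    | tail _ hbc ih =>
      rcases hbc with hbc | ⟨rfl, rfl⟩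
      · exact ih.imp (fun h => h.tail hbc) fun h => ⟨h.1, h.2.tail hbc⟩
      · exact .inr ⟨ih.elim (fun h => h.to_reflTransGen) fun h => h.1, .refl⟩
  intro v hv
  rcases key hv with h' | ⟨h1, h2⟩
  · exact hE v (Relation.TransGen.mono (fun _ _ h => h.1) _ _ h')
  · exact hij (h2.trans h1)

theorem Covered.reverse (hE : Acyclic E) (h : Covered E i j) :
    Covered (ReverseEdge E i j) j i := by
  have hne := h.ne hE
  refine ⟨reverseEdge_self, fun k => ?_⟩
  have hi := hE.not_self i
  have hj := hE.not_self j
  have := h.2 k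
  have := hE.asymm h.1
  unfold ReverseEdge
  grind

theorem reverseEdge_reverseEdge (hE : Acyclic E) (h : E i j) :
    ReverseEdge (ReverseEdge E i j) j i = E := by
  have := hE.asymm h
  ext a b
  unfold ReverseEdge
  grind

theorem ancestorOf_iff {v : V} : AncestorOf E C v ↔ ∃ d ∈ C, Desc E v d := by
  refine ⟨?_, .inr⟩
  rintro (h | h)
  · exact ⟨v, h, .refl⟩
  · exact h

theorem Covered.desc_reverseEdge (hE : Acyclic E) (h : Covered E i j) {v d : V}
    (hd : Desc E v d) : (v ≠ i → Desc (ReverseEdge E i j) v d) ∧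
      (v = i → Desc (ReverseEdge E i j) i d ∨ Desc (ReverseEdge E i j) j d) := by
  induction hd using Relation.ReflTransGen.head_induction_on with
  | refl => exact ⟨fun _ => .refl, fun h => .inl (h ▸ .refl)⟩
  | @head v w hvw _ ih =>
    constructor
    · intro hv
      by_cases hw : w = i
      · subst hw
        have hvj := ((h.2 v).mp hvw).1
        rcases ih.2 rfl with h' | h'
        · exact .head (.inl ⟨hvw, fun h => hv h.1⟩) h'
        · exact .head (.inl ⟨hvj, fun h => hv h.1⟩) h'
      · exact .head (.inl ⟨hvw, fun h => hv h.1⟩) (ih.1 hw)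
    · rintro rfl
      have hw : w ≠ v := by rintro rfl; exact hE.not_self _ hvw
      by_cases hwj : w = j
      · exact .inr (hwj ▸ ih.1 hw)
      · exact .inl (.head (.inl ⟨hvw, fun h => hwj h.2⟩) (ih.1 hw))

theorem Covered.ancestorOf_reverseEdge (hE : Acyclic E) (h : Covered E i j) {v : V} (hv : v ≠ i)
    (ha : AncestorOf E C v) : AncestorOf (ReverseEdge E i j) C v := by
  obtain ⟨d, hd, hvd⟩ := ancestorOf_iff.mp ha
  exact .inr ⟨d, hd, (h.desc_reverseEdge hE hvd).1 hv⟩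

theorem Covered.ancestorOf_reverseEdge_tail (hE : Acyclic E) (h : Covered E i j)
    (ha : AncestorOf E C i) :
    AncestorOf (ReverseEdge E i j) C i ∨ AncestorOf (ReverseEdge E i j) C j := by
  obtain ⟨d, hd, hvd⟩ := ancestorOf_iff.mp ha
  exact ((h.desc_reverseEdge hE hvd).2 rfl).imp (fun h => .inr ⟨d, hd, h⟩) fun h => .inr ⟨d, hd, h⟩

theorem Covered.active_reverseEdge_of_ne (hE : Acyclic E) (h : Covered E i j) {a v b : V}
    (hvi : v ≠ i) (hvj : v ≠ j) (hact : Active E C a v b) :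
    Active (ReverseEdge E i j) C a v b := by
  unfold Active at hact ⊢
  rw [reverseEdge_iff_of_ne (by tauto) (by tauto), reverseEdge_iff_of_ne (by tauto) (by tauto)]
  exact ⟨fun hc => h.ancestorOf_reverseEdge hE hvi (hact.1 hc), hact.2⟩

theorem Active.congr_right {a v b b' : V} (h : Active E C a v b) (hb : E b v ↔ E b' v) :
    Active E C a v b' := by
  unfold Active at h ⊢
  rwa [← hb]

/-- A d-connecting path that is blocked after the reversal of `i → j` at an occurrence of `i`
not preceded by `j` can be rerouted through `j`. -/
theorem Covered.exists_dConn_of_not_active_tail (hE : Acyclic E) (h : Covered E i j) {n : ℕ}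
    {f : ℕ → V} {x y : V} (hf : IsPath E n f x y) (hd : DConn E n f C) {s : ℕ} (hs0 : 0 < s)
    (hsn : s < n) (hsi : f s = i) (hbefore : ∀ t < s, f t ≠ j)
    (hact : ¬ Active (ReverseEdge E i j) C (f (s - 1)) (f s) (f (s + 1))) :
    ∃ n g, IsPath (ReverseEdge E i j) n g x y ∧ DConn (ReverseEdge E i j) n g C := by
  have hE' := h.acyclic_reverseEdge hE
  have hij := h.ne hE
  have hinj := hf.2.2.2.1
  have hf' : IsPath (ReverseEdge E i j) n f x y :=
    ⟨hf.1, hf.2.1, hf.2.2.1, hinj, fun t ht => (h.adj_reverseEdge_iff _ _).mpr (hf.2.2.2.2 t ht)⟩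
  rw [dConn_iff] at hd
  have hi : ∀ u ≤ n, u ≠ s → f u ≠ i := fun u hu hus hui =>
    hus (hinj _ _ hu hsn.le (hui.trans hsi.symm))
  have hother : ∀ u, 0 < u → u < n → u ≠ s → f u ≠ j →
      Active (ReverseEdge E i j) C (f (u - 1)) (f u) (f (u + 1)) := fun u hu0 hun hus huj =>
    h.active_reverseEdge_of_ne hE (hi u hun.le hus) huj (hd u hu0 hun)
  have hai : f (s - 1) ≠ i := hi _ (by omega) (by omega)
  have haj : f (s - 1) ≠ j := hbefore _ (by omega)
  have hbi : f (s + 1) ≠ i := hi _ (by omega) (by omega)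
  have hiff_a : ReverseEdge E i j (f (s - 1)) i ↔ E (f (s - 1)) i :=
    reverseEdge_iff_of_ne (fun h => hij h.2) (fun h => haj h.1)
  have hact_s := hd s hs0 hsn
  rw [hsi] at hact_s hact
  obtain ⟨hai_edge, hnanc, hb⟩ : E (f (s - 1)) i ∧ ¬ AncestorOf (ReverseEdge E i j) C i ∧
      (f (s + 1) ≠ j → E (f (s + 1)) i) := by
    have hiff_b : f (s + 1) ≠ j → (ReverseEdge E i j (f (s + 1)) i ↔ E (f (s + 1)) i) :=
      fun hbj => reverseEdge_iff_of_ne (fun h => hij h.2) (fun h => hbj h.1)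
    by_cases hc : ReverseEdge E i j (f (s - 1)) i ∧ ReverseEdge E i j (f (s + 1)) i
    · exact ⟨hiff_a.mp hc.1, fun hanc => hact ⟨fun _ => hanc, fun hn => absurd hc hn⟩,
        fun hbj => (hiff_b hbj).mp hc.2⟩
    · exact absurd ⟨fun h => absurd h hc, fun _ => hact_s.2 fun hc' =>
        hc ⟨hiff_a.mpr hc'.1, .inl ⟨hc'.2, fun h => hbi h.1⟩⟩⟩ hact
  have haj_edge : E (f (s - 1)) j := ((h.2 _).mp hai_edge).1
  have haj_edge' : ReverseEdge E i j (f (s - 1)) j := .inl ⟨haj_edge, fun h => hai h.1⟩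
  have hanc : f (s + 1) ≠ j → AncestorOf (ReverseEdge E i j) C j := fun hbj =>
    (h.ancestorOf_reverseEdge_tail hE (hact_s.1 ⟨hai_edge, hb hbj⟩)).resolve_left hnanc
  have hprev : 0 < s - 1 →
      Active (ReverseEdge E i j) C (f (s - 1 - 1)) (f (s - 1)) j := fun hs1 => by
    have := hother (s - 1) hs1 (by omega) (by omega) haj
    rw [Nat.sub_add_cancel hs0, hsi] at this
    exact this.congr_right (iff_of_false (hE'.asymm (hiff_a.mpr hai_edge)) (hE'.asymm haj_edge'))
  have hleft : ∀ u, 0 < u → u < s - 1 →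
      Active (ReverseEdge E i j) C (f (u - 1)) (f u) (f (u + 1)) := fun u hu0 hus =>
    hother u hu0 (by omega) (by omega) (hbefore u (by omega))
  by_cases hex : ∃ t ≤ n, f t = j
  · obtain ⟨t, htn, htj⟩ := hex
    have hst : s < t := by
      rcases lt_trichotomy s t with hlt | rfl | hlt
      · exact hlt
      · exact absurd (hsi.symm.trans htj) hij
      · exact absurd htj (hbefore t hlt)
    have hj : ∀ u ≤ n, u ≠ t → f u ≠ j := fun u hu hut huj =>
      hut (hinj _ _ hu htn (huj.trans htj.symm))
    refine exists_dConn_of_shortcut hf' (s := s - 1) (t := t) (by omega) htn ?_ hleft ?_ ?_ ?_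
    · rw [htj]
      exact .inl haj_edge'
    · exact fun u htu hun => hother u (by omega) hun (by omega) (hj u hun.le (by omega))
    · rw [htj]
      exact hprev
    · intro htn
      have hact_t := hd t (by omega) htn
      rw [htj] at hact_t ⊢
      have hiff : ReverseEdge E i j (f (t + 1)) j ↔ E (f (t + 1)) j :=
        reverseEdge_iff_of_ne (fun h' => hi (t + 1) (by omega) (by omega) h'.1)
          (fun h' => hj (t + 1) (by omega) (by omega) h'.1)
      refine ⟨fun hc => ?_, fun hc => hact_t.2 fun hc' => hc ⟨haj_edge', hiff.mpr hc'.2⟩⟩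
      by_cases hts : t = s + 1
      · subst hts
        refine h.ancestorOf_reverseEdge hE hij.symm (hact_t.1 ⟨?_, hiff.mp hc.2⟩)
        rw [Nat.add_sub_cancel, hsi]
        exact h.1
      · exact hanc (hj _ (by omega) (by omega))
  · push Not at hex
    have hbj : f (s + 1) ≠ j := hex _ (by omega)
    have hbi_edge := hb hbj
    have hbj_edge' : ReverseEdge E i j (f (s + 1)) j :=
      .inl ⟨((h.2 _).mp hbi_edge).1, fun h => hbi h.1⟩
    refine exists_dConn_of_replace hf' hs0 hsn hex (.inl haj_edge') (.inr hbj_edge')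
      (fun u hu0 hun _ hus _ => hother u hu0 hun hus (hex u hun.le)) (fun hs1 => hprev (by omega))
      ⟨fun _ => hanc hbj, fun hc => absurd ⟨haj_edge', hbj_edge'⟩ hc⟩ fun hs1 => ?_
    have := hother (s + 1) (by omega) hs1 (by omega) hbj
    rw [Nat.add_sub_cancel, hsi] at this
    exact (this.symm.congr_right (iff_of_false
      (hE'.asymm (.inl ⟨hbi_edge, fun h => hbi h.1⟩)) (hE'.asymm hbj_edge'))).symm

/-- A d-connecting path through `i → j` that is blocked after the reversal of this edge at `j`
only can be shortcut from `i` past `j`. -/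
theorem Covered.exists_dConn_of_not_active_head (hE : Acyclic E) (h : Covered E i j) {n : ℕ}
    {f : ℕ → V} {x y : V} (hf : IsPath E n f x y) (hd : DConn E n f C) {s : ℕ} (hs0 : 0 < s)
    (hsn : s < n) (hsj : f s = j) (hsi : f (s - 1) = i)
    (hact_i : 0 < s - 1 →
      Active (ReverseEdge E i j) C (f (s - 1 - 1)) (f (s - 1)) (f (s - 1 + 1)))
    (hact : ¬ Active (ReverseEdge E i j) C (f (s - 1)) (f s) (f (s + 1))) :
    ∃ n g, IsPath (ReverseEdge E i j) n g x y ∧ DConn (ReverseEdge E i j) n g C := by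
  have hE' := h.acyclic_reverseEdge hE
  have hij := h.ne hE
  have hinj := hf.2.2.2.1
  have hf' : IsPath (ReverseEdge E i j) n f x y :=
    ⟨hf.1, hf.2.1, hf.2.2.1, hinj, fun t ht => (h.adj_reverseEdge_iff _ _).mpr (hf.2.2.2.2 t ht)⟩
  rw [dConn_iff] at hd
  have hi : ∀ u ≤ n, u ≠ s - 1 → f u ≠ i := fun u hu hus hui =>
    hus (hinj _ _ hu (by omega) (hui.trans hsi.symm))
  have hj : ∀ u ≤ n, u ≠ s → f u ≠ j := fun u hu hus hui =>
    hus (hinj _ _ hu (by omega) (hui.trans hsj.symm))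
  have hother : ∀ u, 0 < u → u < n → u ≠ s - 1 → u ≠ s →
      Active (ReverseEdge E i j) C (f (u - 1)) (f u) (f (u + 1)) := fun u hu0 hun hui huj =>
    h.active_reverseEdge_of_ne hE (hi u hun.le hui) (hj u hun.le huj) (hd u hu0 hun)
  have hbi : f (s + 1) ≠ i := hi _ (by omega) (by omega)
  have hact_s := hd s hs0 hsn
  rw [hsj, hsi] at hact_s hact
  have hnij : ¬ ReverseEdge E i j i j := hE'.asymm reverseEdge_self
  have hbj_edge : E (f (s + 1)) j := by
    unfold Active at hact hact_s
    tauto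
  have hbi_edge : E (f (s + 1)) i := (h.2 _).mpr ⟨hbj_edge, hbi⟩
  have hbj_edge' : ReverseEdge E i j (f (s + 1)) j := .inl ⟨hbj_edge, fun h => hbi h.1⟩
  have hbi_edge' : ReverseEdge E i j (f (s + 1)) i := .inl ⟨hbi_edge, fun h => hbi h.1⟩
  refine exists_dConn_of_shortcut hf' (s := s - 1) (t := s + 1) (by omega) (by omega) ?_ ?_ ?_ ?_ ?_
  · rw [hsi]
    exact .inr hbi_edge'
  · exact fun u hu0 hus => hother u hu0 (by omega) (by omega) (by omega)
  · exact fun u hu0 hus => hother u (by omega) (by omega) (by omega) (by omega)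
  · intro hs1
    have := hact_i hs1
    rw [Nat.sub_add_cancel hs0, hsi, hsj] at this
    rw [hsi]
    exact this.congr_right (iff_of_true reverseEdge_self hbi_edge')
  · intro hs1
    have := hother (s + 1) (by omega) hs1 (by omega) (by omega)
    rw [Nat.add_sub_cancel, hsj] at this
    rw [hsi]
    exact (this.symm.congr_right (iff_of_false (hE'.asymm hbj_edge') (hE'.asymm hbi_edge'))).symm

theorem exists_dConn_swap {x y : V} (h : ∃ n g, IsPath E n g y x ∧ DConn E n g C) :
    ∃ n g, IsPath E n g x y ∧ DConn E n g C := by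
  obtain ⟨n, g, hg, hd⟩ := h
  exact ⟨n, _, hg.reverse, hd.reverse⟩

theorem Active.reverse_path {n : ℕ} {f : ℕ → V} {s : ℕ} (hs0 : 0 < s) (hsn : s < n)
    (h : Active E C (f (n - (n - s - 1))) (f (n - (n - s))) (f (n - (n - s + 1)))) :
    Active E C (f (s - 1)) (f s) (f (s + 1)) := by
  have := h.symm
  rwa [show n - (n - s - 1) = s + 1 by omega, show n - (n - s) = s by omega,
    show n - (n - s + 1) = s - 1 by omega] at this

theorem Covered.exists_dConn_reverseEdge (hE : Acyclic E) (h : Covered E i j) {n : ℕ}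
    {f : ℕ → V} {x y : V} (hf : IsPath E n f x y) (hd : DConn E n f C) :
    ∃ n g, IsPath (ReverseEdge E i j) n g x y ∧ DConn (ReverseEdge E i j) n g C := by
  have hij := h.ne hE
  have hinj := hf.2.2.2.1
  by_cases hall : ∀ s, 0 < s → s < n →
      Active (ReverseEdge E i j) C (f (s - 1)) (f s) (f (s + 1))
  · exact ⟨n, f, ⟨hf.1, hf.2.1, hf.2.2.1, hinj, fun t ht =>
      (h.adj_reverseEdge_iff _ _).mpr (hf.2.2.2.2 t ht)⟩, hall⟩
  by_cases htail : ∃ s, 0 < s ∧ s < n ∧ f s = i ∧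
      ¬ Active (ReverseEdge E i j) C (f (s - 1)) (f s) (f (s + 1))
  · obtain ⟨s, hs0, hsn, hsi, hact⟩ := htail
    by_cases hbefore : ∀ t < s, f t ≠ j
    · exact h.exists_dConn_of_not_active_tail hE hf hd hs0 hsn hsi hbefore hact
    push Not at hbefore
    obtain ⟨t, hts, htj⟩ := hbefore
    refine exists_dConn_swap (h.exists_dConn_of_not_active_tail hE hf.reverse hd.reverse
      (s := n - s) (by omega) (by omega) ?_ ?_ fun hc => hact (hc.reverse_path hs0 hsn))
    · rw [← hsi]
      congr 1
      omega
    · intro u hu huj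
      have := hinj _ _ (Nat.sub_le n u) (by omega) (huj.trans htj.symm)
      omega
  push Not at hall htail
  obtain ⟨s, hs0, hsn, hact⟩ := hall
  have hsi : f s ≠ i := fun hsi => hact (htail s hs0 hsn hsi)
  have hsj : f s = j := by
    by_contra hsj
    exact hact (h.active_reverseEdge_of_ne hE hsi hsj (hd s hs0 hsn))
  by_cases ha : f (s - 1) = i
  · exact h.exists_dConn_of_not_active_head hE hf hd hs0 hsn hsj ha
      (fun hs1 => htail _ hs1 (by omega) ha) hact
  by_cases hb : f (s + 1) = i
  · have hs : n - (n - s) = s := by omega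
    have hs1 : n - (n - s - 1) = s + 1 := by omega
    refine exists_dConn_swap (h.exists_dConn_of_not_active_head hE hf.reverse hd.reverse
      (s := n - s) (by omega) (by omega) (by simpa [hs] using hsj) (by simpa [hs1] using hb) ?_
      fun hc => hact (hc.reverse_path hs0 hsn))
    intro hpos
    have := (htail (s + 1) (by omega) (by omega) hb).symm
    rwa [hs1, show n - (n - s - 1 - 1) = s + 1 + 1 by omega,
      show n - (n - s - 1 + 1) = s + 1 - 1 by omega]
  · refine absurd ?_ hact
    have hact_s : Active E C (f (s - 1)) (f s) (f (s + 1)) := hd s hs0 hsn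
    have hanc : AncestorOf E C j → AncestorOf (ReverseEdge E i j) C j :=
      h.ancestorOf_reverseEdge hE hij.symm
    unfold Active at hact_s ⊢
    rw [hsj] at hact_s ⊢
    rw [reverseEdge_iff_of_ne (by tauto) (by tauto), reverseEdge_iff_of_ne (by tauto) (by tauto)]
    exact ⟨fun hc => hanc (hact_s.1 hc), hact_s.2⟩

theorem Covered.dSep_of_dSep_reverseEdge (hE : Acyclic E) (h : Covered E i j) {x y : V}
    (hs : DSep (ReverseEdge E i j) x y C) : DSep E x y C := by
  intro n f hf hd
  obtain ⟨m, g, hg, hg'⟩ := h.exists_dConn_reverseEdge hE hf hd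
  exact hs m g hg hg'

theorem Covered.markovEquiv_reverseEdge (hE : Acyclic E) (h : Covered E i j) :
    MarkovEquiv E (ReverseEdge E i j) := by
  have key (x y : V) (C : Finset V) : DSep E x y C ↔ DSep (ReverseEdge E i j) x y C := by
    refine ⟨fun hs => ?_, h.dSep_of_dSep_reverseEdge hE⟩
    refine (h.reverse hE).dSep_of_dSep_reverseEdge (h.acyclic_reverseEdge hE) ?_
    rwa [reverseEdge_reverseEdge hE h.1]
  ext ⟨x, y, C⟩
  simp [Indep, key]

theorem MarkovEquiv.exists_covered [Finite V] (hE : Acyclic E) (hE' : Acyclic E')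
    (h : MarkovEquiv E E') (hne : E ≠ E') : ∃ x y, Covered E x y ∧ ¬ E' x y := by
  have hS := h.sameSkeleton hE hE'
  have hex : {y | ∃ x, E x y ∧ ¬ E' x y}.Nonempty := by
    by_contra hempty
    have hle : ∀ x y, E x y → E' x y := fun x y hxy => by
      by_contra hn
      exact hempty ⟨y, x, hxy, hn⟩
    refine hne (funext₂ fun x y => propext ⟨hle x y, fun hxy => ?_⟩)
    exact ((hS x y).mpr (.inl hxy)).resolve_right fun hyx => hE'.asymm hxy (hle _ _ hyx)
  obtain ⟨y, hy, hmin⟩ := hE.wellFounded.has_min _ hex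
  obtain ⟨x, ⟨hxy, hxy'⟩, hmax⟩ := hE.flip.wellFounded.has_min {x | E x y ∧ ¬ E' x y} hy
  have hpres {w z : V} (hw : E w y) (hz : E z w) : E' z w := by
    by_contra hn
    exact hmin w ⟨z, hz, hn⟩ hw
  have hyx' : E' y x := ((hS x y).mp (.inl hxy)).resolve_left hxy'
  refine ⟨x, y, ⟨hxy, fun z => ⟨fun hzx => ?_, ?_⟩⟩, hxy'⟩
  · have hzy : z ≠ y := by
      rintro rfl
      exact hE.asymm hxy hzx
    refine ⟨?_, by rintro rfl; exact hE.not_self _ hzx⟩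
    by_contra hn
    by_cases hadj : Adj E z y
    · exact hE y ((Relation.TransGen.single (hadj.resolve_left hn)).tail hzx |>.tail hxy)
    · exact hE.asymm hxy (MarkovEquiv.edge_of_vStruct hE' hE (Eq.symm h) hyx' (hpres hxy hzx)
        hzy.symm fun h' => hadj ((hS _ _).mpr h').symm)
  · rintro ⟨hzy, hzx⟩
    by_contra hn
    by_cases hadj : Adj E z x
    · have hxz : E x z := hadj.resolve_left hn
      have hxz' : E' x z := hpres hzy hxz
      refine hmax z ⟨hzy, fun hzy' => ?_⟩ hxz
      exact hE' y ((Relation.TransGen.single hyx').tail hxz' |>.tail hzy')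
    · exact hxy' (h.edge_of_vStruct hE hE' hxy hzy (Ne.symm hzx) fun h' => hadj h'.symm)

theorem MarkovEquiv.reflTransGen_coveredFlip [Finite V] (hE : Acyclic E) (hE' : Acyclic E')
    (h : MarkovEquiv E E') : Relation.ReflTransGen CoveredFlip E E' := by
  induction hN : {e : V × V | E e.1 e.2 ∧ ¬ E' e.1 e.2}.ncard using Nat.strong_induction_on
    generalizing E with
  | _ N ih =>
    by_cases hne : E = E'
    · exact hne ▸ .refl
    obtain ⟨x, y, hxy, hxy'⟩ := h.exists_covered hE hE' hne
    have hacyc := hxy.acyclic_reverseEdge hE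
    refine .head ⟨hE, hacyc, x, y, hxy, rfl⟩ (ih _ ?_ hacyc
      ((hxy.markovEquiv_reverseEdge hE).symm.trans h) rfl)
    rw [← hN]
    have hyx' : E' y x := ((h.sameSkeleton hE hE' x y).mp (.inl hxy.1)).resolve_left hxy'
    refine Set.ncard_lt_ncard ⟨?_, fun hsub => ?_⟩ (Set.toFinite _)
    · rintro ⟨a, b⟩ ⟨hab | ⟨rfl, rfl⟩, hab'⟩
      · exact ⟨hab.1, hab'⟩
      · exact absurd hyx' hab'
    · exact hacyc.asymm reverseEdge_self (hsub (show (x, y) ∈ _ from ⟨hxy.1, hxy'⟩)).1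

end Helpers

/-- **Chickering's transformational characterization.** Two DAGs `G` and `G'` on
`Fin p` are Markov equivalent if and only if there is a finite sequence of DAGs
`G = G₀, G₁, …, G_M = G'` in which each `G_{t+1}` is obtained from `G_t` by
reversing a single covered edge of `G_t`. -/
theorem markovEquiv_iff_coveredFlip_sequence {p : ℕ} (G G' : Fin p → Fin p → Prop)
    (hG : Acyclic G) (hG' : Acyclic G') :
    MarkovEquiv G G' ↔ Relation.ReflTransGen CoveredFlip G G' := by
  refine ⟨fun h => h.reflTransGen_coveredFlip hG hG', fun h => ?_⟩
  induction h with
  | refl => exact rfl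
  | tail _ hstep ih =>
    obtain ⟨hE, -, i, j, hcov, rfl⟩ := hstep
    exact (ih hE).trans (hcov.markovEquiv_reverseEdge hE)

end CausalDiscovery
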